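/- arXiv:1311.3359 — 6 statements merged into one kernel-verified Lean document; each statement's English description precedes it below -/
import Mathlib

section
/- Let $M$ and $\Theta$ be arbitrary $m\times m$ real matrices and let $a, \lambda$ be real scalars. Define the $2m\times 2m$ matrices $\tilde{\Delta} = \begin{pmatrix} M + a\Theta - \lambda I & \lambda I \\ \lambda I & M - a\Theta - \lambda I \end{pmatrix}$ and $\Upsilon = \begin{pmatrix} M & a\Theta \\ a\Theta & M - 2\lambda I \end{pmatrix}$. Then for every integer $k \ge 0$, $\tilde{\Delta}^k \begin{pmatrix} I \\ I \end{pmatrix} = \begin{pmatrix} A_k + B_k \\ A_k - B_k \end{pmatrix}$, where $\begin{pmatrix} A_k \\ B_k \end{pmatrix} = \Upsilon^k \begin{pmatrix} I \\ 0 \end{pmatrix}$. -/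
open Matrix

/-- Equation (2.6) of the paper: powers of `Δ̃` applied to `(I; I)` are determined
by powers of `Υ` applied to `(I; 0)`. -/
theorem deltaTilde_pow_apply_ones {m : ℕ}
    (M Θ : Matrix (Fin m) (Fin m) ℝ) (a lam : ℝ)
    (Δ Υ : Matrix (Fin m ⊕ Fin m) (Fin m ⊕ Fin m) ℝ)
    (hΔ : Δ = Matrix.fromBlocks
        (M + a • Θ - lam • (1 : Matrix (Fin m) (Fin m) ℝ))
        (lam • (1 : Matrix (Fin m) (Fin m) ℝ))
        (lam • (1 : Matrix (Fin m) (Fin m) ℝ))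
        (M - a • Θ - lam • (1 : Matrix (Fin m) (Fin m) ℝ)))
    (hΥ : Υ = Matrix.fromBlocks M (a • Θ) (a • Θ)
        (M - (2 * lam) • (1 : Matrix (Fin m) (Fin m) ℝ)))
    (A B : ℕ → Matrix (Fin m) (Fin m) ℝ)
    (hA : ∀ k : ℕ, A k = ((Υ ^ k)
        * Matrix.fromRows (1 : Matrix (Fin m) (Fin m) ℝ) (0 : Matrix (Fin m) (Fin m) ℝ)).submatrix
          Sum.inl id)
    (hB : ∀ k : ℕ, B k = ((Υ ^ k)
        * Matrix.fromRows (1 : Matrix (Fin m) (Fin m) ℝ) (0 : Matrix (Fin m) (Fin m) ℝ)).submatrix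
          Sum.inr id) :
    ∀ k : ℕ,
      (Δ ^ k) * Matrix.fromRows (1 : Matrix (Fin m) (Fin m) ℝ) (1 : Matrix (Fin m) (Fin m) ℝ)
        = Matrix.fromRows (A k + B k) (A k - B k) := by
  have hrows : ∀ k, Υ ^ k * Matrix.fromRows (1 : Matrix (Fin m) (Fin m) ℝ)
      (0 : Matrix (Fin m) (Fin m) ℝ) = Matrix.fromRows (A k) (B k) := by
    intro k
    rw [hA, hB]
    ext (i | i) j <;> rfl
  have hstep : ∀ k, Matrix.fromRows (A (k + 1)) (B (k + 1)) =
      Matrix.fromRows (M * A k + (a • Θ) * B k)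
        ((a • Θ) * A k + (M - (2 * lam) • (1 : Matrix (Fin m) (Fin m) ℝ)) * B k) := by
    intro k
    rw [← hrows, pow_succ', Matrix.mul_assoc, hrows, hΥ, Matrix.fromBlocks_mul_fromRows]
  intro k
  induction k with
  | zero =>
    have h := hrows 0
    rw [pow_zero, Matrix.one_mul] at h
    obtain ⟨h₁, h₂⟩ := Matrix.fromRows_inj h
    simp [← h₁, ← h₂]
  | succ k ih =>
    obtain ⟨h₁, h₂⟩ := Matrix.fromRows_inj (hstep k)
    rw [pow_succ', Matrix.mul_assoc, ih, hΔ, Matrix.fromBlocks_mul_fromRows, h₁, h₂]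
    congr 1 <;>
    · simp only [Matrix.add_mul, Matrix.sub_mul, Matrix.mul_add, Matrix.mul_sub,
        Matrix.smul_mul, Matrix.one_mul]
      module
end

section
/- Let $\Theta = \mathrm{diag}(\sigma_1,\dots,\sigma_m)$ be a diagonal real matrix with all $\sigma_i > 0$, and let $\Psi$ be an $m\times m$ real matrix with nonnegative entries whose row sums are all at most $1$. If $(I - \Psi)\,\Theta^{-1}\,(I - \Psi) = 0$, then $\Psi = I$. -/
open Matrix

/-- A step in the proof of Proposition A.1: if `Ψ` is a substochastic matrix and
`(I - Ψ) Θ⁻¹ (I - Ψ) = 0` with `Θ` a positive diagonal matrix, then `Ψ = I`. -/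
theorem substochastic_of_nilpotent_factor_eq_id {m : ℕ}
    (σ : Fin m → ℝ) (hσ : ∀ i, 0 < σ i)
    (Θ : Matrix (Fin m) (Fin m) ℝ) (hΘ : Θ = Matrix.diagonal σ)
    (Ψ : Matrix (Fin m) (Fin m) ℝ)
    (hΨnonneg : ∀ i j : Fin m, 0 ≤ Ψ i j)
    (hΨrow : ∀ i : Fin m, ∑ j, Ψ i j ≤ 1)
    (h : ((1 : Matrix (Fin m) (Fin m) ℝ) - Ψ) * Θ⁻¹ * ((1 : Matrix (Fin m) (Fin m) ℝ) - Ψ) = 0) :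
    Ψ = 1 := by
  have hinv : Θ⁻¹ = Matrix.diagonal fun i => (σ i)⁻¹ := by
    rw [hΘ]
    refine Matrix.inv_eq_right_inv ?_
    rw [Matrix.diagonal_mul_diagonal, ← Matrix.diagonal_one]
    congr 1
    funext i
    exact mul_inv_cancel₀ (hσ i).ne'
  have hdiag : ∀ i, Ψ i i = 1 := by
    intro i
    have hsum : ∑ j, (1 - Ψ) i j * (σ j)⁻¹ * (1 - Ψ) j i = 0 := by
      have hii := congrFun (congrFun h i) i
      rw [hinv, Matrix.mul_apply] at hii
      simpa only [Matrix.mul_diagonal, Matrix.zero_apply] using hii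
    have hnonneg : ∀ j ∈ Finset.univ, 0 ≤ (1 - Ψ) i j * (σ j)⁻¹ * (1 - Ψ) j i := by
      intro j _
      have hj : 0 ≤ (σ j)⁻¹ := (inv_pos.mpr (hσ j)).le
      rw [mul_right_comm]
      refine mul_nonneg ?_ hj
      rcases eq_or_ne i j with rfl | hij
      · exact mul_self_nonneg _
      · rw [Matrix.sub_apply, Matrix.sub_apply, Matrix.one_apply_ne hij,
          Matrix.one_apply_ne hij.symm, zero_sub, zero_sub, neg_mul_neg]
        exact mul_nonneg (hΨnonneg i j) (hΨnonneg j i)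
    have hi := (Finset.sum_eq_zero_iff_of_nonneg hnonneg).mp hsum i (Finset.mem_univ i)
    have hσi := inv_ne_zero (hσ i).ne'
    rw [mul_right_comm, mul_eq_zero, or_iff_left hσi, mul_self_eq_zero, Matrix.sub_apply,
      Matrix.one_apply_eq] at hi
    linarith
  ext i j
  rcases eq_or_ne i j with rfl | hij
  · rw [hdiag, Matrix.one_apply_eq]
  · rw [Matrix.one_apply_ne hij]
    have hle : Ψ i i + Ψ i j ≤ ∑ k, Ψ i k := by
      rw [← Finset.sum_pair hij]
      exact Finset.sum_le_sum_of_subset_of_nonneg (Finset.subset_univ _)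
        fun k _ _ => hΨnonneg i k
    linarith [hΨrow i, hdiag i, hΨnonneg i j]
end

section
/- Fix $m \ge 1$, let $Q$ be an $m\times m$ real matrix with nonnegative off-diagonal entries and zero row sums (a generator), let $D$ be a real diagonal matrix, let $\Theta = \mathrm{diag}(\sigma_1,\dots,\sigma_m)$ with all $\sigma_i > 0$, and let $\varepsilon_0 > 0$ be such that for all $\varepsilon \in (0,\varepsilon_0)$ the diagonal matrices $\Theta + \varepsilon D$ and $\Theta - \varepsilon D$ have strictly positive diagonal entries. Suppose that for each $\varepsilon \in (0,\varepsilon_0)$, $\Psi_\varepsilon$ is an $m\times m$ real matrix with nonnegative entries and row sums at most $1$ satisfying the Riccati equation $(\varepsilon D + \Theta)^{-1} + (\varepsilon D + \Theta)^{-1}(\varepsilon^2 Q - I)\Psi_\varepsilon + \Psi_\varepsilon(\Theta - \varepsilon D)^{-1}(\varepsilon^2 Q - I) + \Psi_\varepsilon(\Theta - \varepsilon D)^{-1}\Psi_\varepsilon = 0$. Then $\Psi_\varepsilon \to I$ entrywise as $\varepsilon \to 0^+$. -/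
open Matrix Filter

/-- A nonnegative matrix `P` with row sums at most one and `(1 - P) S (1 - P) = 0` for a positive
diagonal matrix `S` is the identity: `S (1 - P)` is nilpotent, so its trace vanishes. -/
theorem eq_one_of_one_sub_mul_diagonal_mul_one_sub {n : Type*} [Fintype n] [DecidableEq n]
    {P : Matrix n n ℝ} {s : n → ℝ} (hs : ∀ i, 0 < s i) (hP : ∀ i j, 0 ≤ P i j)
    (hrow : ∀ i, ∑ j, P i j ≤ 1)
    (h : (1 - P) * Matrix.diagonal s * (1 - P) = 0) : P = 1 := by
  have hnil : IsNilpotent (Matrix.diagonal s * (1 - P)) :=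
    ⟨2, by rw [pow_two, Matrix.mul_assoc, ← Matrix.mul_assoc (1 - P), h, Matrix.mul_zero]⟩
  have htr : ∑ i, s i * (1 - P i i) = 0 := by
    simpa [Matrix.trace, Matrix.diagonal_mul] using
      (Matrix.isNilpotent_trace_of_isNilpotent hnil).eq_zero
  have hle (i j : n) : P i j ≤ 1 :=
    (Finset.single_le_sum (fun k _ => hP i k) (Finset.mem_univ j)).trans (hrow i)
  have hdiag (i : n) : P i i = 1 := by
    have hi := (Finset.sum_eq_zero_iff_of_nonneg fun k _ =>
      mul_nonneg (hs k).le (sub_nonneg.2 (hle k k))).1 htr i (Finset.mem_univ i)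
    have := (mul_eq_zero.1 hi).resolve_left (hs i).ne'
    linarith
  ext i j
  rcases eq_or_ne i j with rfl | hij
  · simp [hdiag]
  · have hpair : P i i + P i j ≤ ∑ k, P i k := by
      rw [← Finset.sum_pair hij]
      exact Finset.sum_le_sum_of_subset_of_nonneg (Finset.subset_univ _) fun k _ _ => hP i k
    rw [Matrix.one_apply_ne hij]
    linarith [hP i j, hrow i, hdiag i]

/-- The matrix inverse is continuous at matrices with nonzero determinant. -/
theorem tendsto_matrix_inv {α n : Type*} [Fintype n] [DecidableEq n] {l : Filter α}
    {f : α → Matrix n n ℝ} {A : Matrix n n ℝ} (hA : A.det ≠ 0) (hf : Tendsto f l (nhds A)) :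
    Tendsto (fun x => (f x)⁻¹) l (nhds A⁻¹) := by
  refine (continuousAt_matrix_inv A ?_).tendsto.comp hf
  rw [Ring.inverse_eq_inv']
  exact continuousAt_inv₀ hA

/-- Proposition A.1: the first-passage probability matrices `Ψ_ε`, solutions of
the Riccati equation, converge entrywise to the identity as `ε → 0⁺`. -/
theorem riccati_solution_tendsto_id {m : ℕ} (hm : 1 ≤ m)
    (Q : Matrix (Fin m) (Fin m) ℝ)
    (hQoff : ∀ i j : Fin m, i ≠ j → 0 ≤ Q i j)
    (hQrow : ∀ i : Fin m, ∑ j, Q i j = 0)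
    (d σ : Fin m → ℝ) (hσ : ∀ i, 0 < σ i)
    (D Θ : Matrix (Fin m) (Fin m) ℝ)
    (hD : D = Matrix.diagonal d) (hΘ : Θ = Matrix.diagonal σ)
    (ε₀ : ℝ) (hε₀ : 0 < ε₀)
    (hpos : ∀ ε : ℝ, 0 < ε → ε < ε₀ → ∀ i : Fin m,
      0 < σ i + ε * d i ∧ 0 < σ i - ε * d i)
    (Ψ : ℝ → Matrix (Fin m) (Fin m) ℝ)
    (hΨnonneg : ∀ ε : ℝ, 0 < ε → ε < ε₀ → ∀ i j : Fin m, 0 ≤ Ψ ε i j)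
    (hΨrow : ∀ ε : ℝ, 0 < ε → ε < ε₀ → ∀ i : Fin m, ∑ j, Ψ ε i j ≤ 1)
    (hriccati : ∀ ε : ℝ, 0 < ε → ε < ε₀ →
      (ε • D + Θ)⁻¹
        + (ε • D + Θ)⁻¹ * (ε ^ 2 • Q - 1) * Ψ ε
        + Ψ ε * (Θ - ε • D)⁻¹ * (ε ^ 2 • Q - 1)
        + Ψ ε * (Θ - ε • D)⁻¹ * Ψ ε = 0) :
    ∀ i j : Fin m,
      Tendsto (fun ε : ℝ => Ψ ε i j) (nhdsWithin 0 (Set.Ioi 0))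
        (nhds ((1 : Matrix (Fin m) (Fin m) ℝ) i j)) := by
  have hdet : Θ.det ≠ 0 := by
    rw [hΘ, Matrix.det_diagonal]
    exact Finset.prod_ne_zero_iff.2 fun i _ => (hσ i).ne'
  have hinv : Θ⁻¹ = Matrix.diagonal fun i => (σ i)⁻¹ := by
    refine Matrix.inv_eq_right_inv ?_
    rw [hΘ, Matrix.diagonal_mul_diagonal, ← Matrix.diagonal_one]
    exact congrArg _ (funext fun i => mul_inv_cancel₀ (hσ i).ne')
  let K : Set (Matrix (Fin m) (Fin m) ℝ) := Set.univ.pi fun _ => Set.univ.pi fun _ => Set.Icc 0 1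
  have hK : IsCompact K := isCompact_univ_pi fun _ => isCompact_univ_pi fun _ => isCompact_Icc
  suffices hmain : Tendsto Ψ (nhdsWithin 0 (Set.Ioi 0)) (nhds 1) from fun i j =>
    tendsto_pi_nhds.1 (tendsto_pi_nhds.1 hmain i) j
  refine tendsto_iff_ultrafilter _ _ _ |>.2 fun U hU => ?_
  have hsmall : ∀ᶠ ε : ℝ in U, 0 < ε ∧ ε < ε₀ := hU (Ioo_mem_nhdsGT hε₀)
  have hmem : ∀ᶠ ε in U, Ψ ε ∈ K := hsmall.mono fun ε hε i _ j _ =>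
    ⟨hΨnonneg ε hε.1 hε.2 i j,
      (Finset.single_le_sum (fun k _ => hΨnonneg ε hε.1 hε.2 i k) (Finset.mem_univ j)).trans
        (hΨrow ε hε.1 hε.2 i)⟩
  obtain ⟨P, -, hP⟩ := hK.ultrafilter_le_nhds (U.map Ψ) (le_principal_iff.2 hmem)
  have hlim : Tendsto Ψ U (nhds P) := hP
  have hentry (i j : Fin m) : Tendsto (fun ε => Ψ ε i j) U (nhds (P i j)) :=
    tendsto_pi_nhds.1 (tendsto_pi_nhds.1 hlim i) j
  have hid : Tendsto (fun ε : ℝ => ε) U (nhds 0) := hU.trans nhdsWithin_le_nhds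
  have hplus : Tendsto (fun ε : ℝ => (ε • D + Θ)⁻¹) U (nhds Θ⁻¹) :=
    tendsto_matrix_inv hdet (by simpa using (hid.smul_const D).add_const Θ)
  have hminus : Tendsto (fun ε : ℝ => (Θ - ε • D)⁻¹) U (nhds Θ⁻¹) :=
    tendsto_matrix_inv hdet (by simpa using (hid.smul_const D).const_sub Θ)
  have hgen : Tendsto (fun ε : ℝ => ε ^ 2 • Q - 1) U (nhds (-1)) := by
    simpa using ((hid.pow 2).smul_const Q).sub_const 1
  have hlimit : Θ⁻¹ + Θ⁻¹ * (-1) * P + P * Θ⁻¹ * (-1) + P * Θ⁻¹ * P = 0 :=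
    tendsto_nhds_unique_of_eventuallyEq
      (((hplus.add ((hplus.mul hgen).mul hlim)).add ((hlim.mul hminus).mul hgen)).add
        ((hlim.mul hminus).mul hlim))
      tendsto_const_nhds (hsmall.mono fun ε hε => hriccati ε hε.1 hε.2)
  have hPone : P = 1 := by
    refine eq_one_of_one_sub_mul_diagonal_mul_one_sub (s := fun i => (σ i)⁻¹)
      (fun i => inv_pos.2 (hσ i))
      (fun i j => ge_of_tendsto (hentry i j)
        (hsmall.mono fun ε hε => hΨnonneg ε hε.1 hε.2 i j))
      (fun i => le_of_tendsto (tendsto_finsetSum _ fun j _ => hentry i j)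
        (hsmall.mono fun ε hε => hΨrow ε hε.1 hε.2 i)) ?_
    rw [← hinv, ← hlimit]
    noncomm_ring
  rwa [hPone] at hlim
end

section
/- Fix $m \ge 2$, let $Q \ne 0$ be an $m\times m$ real matrix with nonnegative off-diagonal entries and zero row sums (a generator), let $D$ be a real diagonal matrix, let $\Theta = \mathrm{diag}(\sigma_1,\dots,\sigma_m)$ with all $\sigma_i > 0$, set $V = \Theta^2$, and let $\varepsilon_0 > 0$ be such that for all $\varepsilon \in (0,\varepsilon_0)$ the diagonal matrices $\Theta + \varepsilon D$ and $\Theta - \varepsilon D$ have strictly positive diagonal entries. Suppose that for each $\varepsilon \in (0,\varepsilon_0)$, $\Psi_\varepsilon$ is an $m\times m$ real matrix with nonnegative entries and row sums at most $1$ satisfying the Riccati equation $(\varepsilon D + \Theta)^{-1} + (\varepsilon D + \Theta)^{-1}(\varepsilon^2 Q - I)\Psi_\varepsilon + \Psi_\varepsilon(\Theta - \varepsilon D)^{-1}(\varepsilon^2 Q - I) + \Psi_\varepsilon(\Theta - \varepsilon D)^{-1}\Psi_\varepsilon = 0$. Then (i) the family $(1/\varepsilon)(\Psi_\varepsilon -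 I)$ is bounded: there exist $C > 0$ and $\varepsilon_1 \in (0,\varepsilon_0)$ such that every entry of $(1/\varepsilon)(\Psi_\varepsilon - I)$ has absolute value at most $C$ for all $\varepsilon \in (0,\varepsilon_1)$; and (ii) for every sequence $\varepsilon_k \to 0^+$ such that $(1/\varepsilon_k)(\Psi_{\varepsilon_k} - I)$ converges entrywise to a matrix $\bar{Y}$, the limit satisfies $(\Theta^{-1}\bar{Y})^2 + 2V^{-1}D\,\Theta^{-1}\bar{Y} + 2V^{-1}Q = 0$. -/
open Matrix Filter

/-- The Riccati equation rewritten for the rescaled increment `Y`, where `Ψ = 1 + ε Y`. -/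
lemma riccati_rescaled {n : Type*} [Fintype n] [DecidableEq n]
    {A B G Q Y : Matrix n n ℝ} {ε : ℝ} (hε : ε ≠ 0) (hBA : B = A + ε • G)
    (h : A + A * (ε ^ 2 • Q - 1) * (1 + ε • Y) + (1 + ε • Y) * B * (ε ^ 2 • Q - 1)
      + (1 + ε • Y) * B * (1 + ε • Y) = 0) :
    Y * B * Y + G * Y + A * Q * (1 + ε • Y) + (1 + ε • Y) * B * Q = 0 := by
  have hBY : B * Y = A * Y + ε • (G * Y) := by rw [hBA, add_mul, smul_mul_assoc]
  have key : ε ^ 2 • (Y * B * Y + G * Y + A * Q * (1 + ε • Y) + (1 + ε • Y) * B * Q) = 0 := by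
    rw [← h]
    simp only [mul_add, add_mul, mul_sub, sub_mul, smul_mul_assoc, mul_smul_comm, mul_one,
      one_mul, smul_add, smul_sub, smul_smul, hBY]
    module
  exact (smul_eq_zero.mp key).resolve_left (pow_ne_zero 2 hε)

lemma inv_diagonal_of_pos {n : Type*} [Fintype n] [DecidableEq n] {v : n → ℝ}
    (hv : ∀ i, 0 < v i) : (diagonal v)⁻¹ = diagonal fun i => (v i)⁻¹ := by
  apply Matrix.inv_eq_right_inv
  rw [diagonal_mul_diagonal, ← diagonal_one]
  congr 1
  ext i
  exact mul_inv_cancel₀ (hv i).ne'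

lemma abs_le_of_sq_le_mul_abs_add {x p q : ℝ} (hp : 0 ≤ p) (hq : 0 ≤ q)
    (h : x ^ 2 ≤ p * |x| + q) : |x| ≤ p + q + 1 := by
  by_contra! hx
  rw [← sq_abs] at h
  nlinarith

lemma abs_apply_le_abs_diag {n : Type*} [Fintype n] {Y : Matrix n n ℝ}
    (hoff : ∀ i j, i ≠ j → 0 ≤ Y i j) (hrow : ∀ i, ∑ j, Y i j ≤ 0) (i j : n) :
    |Y i j| ≤ |Y i i| := by
  classical
  by_cases hij : i = j
  · rw [hij]
  rw [abs_of_nonneg (hoff i j hij)]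
  have h1 := hrow i
  rw [← Finset.add_sum_erase _ _ (Finset.mem_univ i)] at h1
  have h2 : Y i j ≤ ∑ k ∈ Finset.univ.erase i, Y i k :=
    Finset.single_le_sum (f := fun k => Y i k)
      (fun k hk => hoff i k (Finset.ne_of_mem_erase hk).symm)
      (Finset.mem_erase.mpr ⟨Ne.symm hij, Finset.mem_univ j⟩)
  linarith [neg_le_abs (Y i i)]

lemma mul_sq_diag_le {n : Type*} [Fintype n] [DecidableEq n] {Y : Matrix n n ℝ} {b : n → ℝ}
    (hb : ∀ i, 0 ≤ b i) (hoff : ∀ i j, i ≠ j → 0 ≤ Y i j) (i : n) :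
    b i * Y i i ^ 2 ≤ (Y * diagonal b * Y) i i := by
  rw [Matrix.mul_apply]
  simp only [mul_diagonal]
  rw [← Finset.add_sum_erase _ _ (Finset.mem_univ i)]
  have : 0 ≤ ∑ k ∈ Finset.univ.erase i, Y i k * b k * Y k i :=
    Finset.sum_nonneg fun k hk =>
      have hk' := Finset.ne_of_mem_erase hk
      mul_nonneg (mul_nonneg (hoff i k hk'.symm) (hb k)) (hoff k i hk')
  linarith

/-- Proposition A.3: the matrices `(1/ε)(Ψ_ε - I)` are bounded, and every
entrywise limit `Ȳ` along a sequence `ε_k → 0⁺` satisfies the quadratic matrix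
equation `(Θ⁻¹ Ȳ)² + 2V⁻¹D (Θ⁻¹ Ȳ) + 2V⁻¹Q = 0`. -/
theorem riccati_first_order_bounded_and_limit_solves_quadratic {m : ℕ} (hm : 2 ≤ m)
    (Q : Matrix (Fin m) (Fin m) ℝ) (hQne : Q ≠ 0)
    (hQoff : ∀ i j : Fin m, i ≠ j → 0 ≤ Q i j)
    (hQrow : ∀ i : Fin m, ∑ j, Q i j = 0)
    (d σ : Fin m → ℝ) (hσ : ∀ i, 0 < σ i)
    (D Θ V : Matrix (Fin m) (Fin m) ℝ)
    (hD : D = Matrix.diagonal d) (hΘ : Θ = Matrix.diagonal σ) (hV : V = Θ ^ 2)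
    (ε₀ : ℝ) (hε₀ : 0 < ε₀)
    (hpos : ∀ ε : ℝ, 0 < ε → ε < ε₀ → ∀ i : Fin m,
      0 < σ i + ε * d i ∧ 0 < σ i - ε * d i)
    (Ψ : ℝ → Matrix (Fin m) (Fin m) ℝ)
    (hΨnonneg : ∀ ε : ℝ, 0 < ε → ε < ε₀ → ∀ i j : Fin m, 0 ≤ Ψ ε i j)
    (hΨrow : ∀ ε : ℝ, 0 < ε → ε < ε₀ → ∀ i : Fin m, ∑ j, Ψ ε i j ≤ 1)
    (hriccati : ∀ ε : ℝ, 0 < ε → ε < ε₀ →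
      (ε • D + Θ)⁻¹
        + (ε • D + Θ)⁻¹ * (ε ^ 2 • Q - 1) * Ψ ε
        + Ψ ε * (Θ - ε • D)⁻¹ * (ε ^ 2 • Q - 1)
        + Ψ ε * (Θ - ε • D)⁻¹ * Ψ ε = 0) :
    (∃ C : ℝ, 0 < C ∧ ∃ ε₁ : ℝ, 0 < ε₁ ∧ ε₁ < ε₀ ∧
      ∀ ε : ℝ, 0 < ε → ε < ε₁ → ∀ i j : Fin m,
        |(1 / ε) * ((Ψ ε - 1) i j)| ≤ C)
    ∧ ∀ (e : ℕ → ℝ), (∀ k, e k ∈ Set.Ioo 0 ε₀) → Tendsto e atTop (nhds 0) →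
        ∀ Ybar : Matrix (Fin m) (Fin m) ℝ,
          (∀ i j : Fin m,
            Tendsto (fun k : ℕ => (1 / e k) * ((Ψ (e k) - 1) i j)) atTop (nhds (Ybar i j))) →
          (Θ⁻¹ * Ybar) ^ 2 + (2 : ℝ) • (V⁻¹ * D) * (Θ⁻¹ * Ybar) + (2 : ℝ) • (V⁻¹ * Q) = 0 := by
  subst hD hΘ hV
  have hΘε : ∀ ε : ℝ, ε • diagonal d + diagonal σ = diagonal fun i => σ i + ε * d i := by
    intro ε
    rw [← diagonal_smul, diagonal_add]
    congr 1
    ext i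
    simp [add_comm]
  have hΘε' : ∀ ε : ℝ, diagonal σ - ε • diagonal d = diagonal fun i => σ i - ε * d i := by
    intro ε
    rw [← diagonal_smul, diagonal_sub]
    congr 1
  set a : ℝ → Fin m → ℝ := fun ε i => (σ i + ε * d i)⁻¹ with ha
  set b : ℝ → Fin m → ℝ := fun ε i => (σ i - ε * d i)⁻¹ with hb
  set g : ℝ → Fin m → ℝ := fun ε i => 2 * d i * a ε i * b ε i with hg
  set Y : ℝ → Matrix (Fin m) (Fin m) ℝ := fun ε => (1 / ε) • (Ψ ε - 1) with hY
  have hΨY : ∀ ε : ℝ, 0 < ε → Ψ ε = 1 + ε • Y ε := by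
    intro ε h
    simp only [hY, smul_smul]
    rw [mul_one_div_cancel h.ne', one_smul]
    abel
  have heq : ∀ ε : ℝ, 0 < ε → ε < ε₀ →
      Y ε * diagonal (b ε) * Y ε + diagonal (g ε) * Y ε + diagonal (a ε) * Q * Ψ ε
        + Ψ ε * diagonal (b ε) * Q = 0 := by
    intro ε h0 h1
    have h := hriccati ε h0 h1
    rw [hΘε, hΘε', inv_diagonal_of_pos fun i => (hpos ε h0 h1 i).1,
      inv_diagonal_of_pos fun i => (hpos ε h0 h1 i).2, hΨY ε h0] at h
    rw [hΨY ε h0]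
    refine riccati_rescaled h0.ne' ?_ h
    rw [← diagonal_smul, diagonal_add]
    congr 1
    ext i
    have h2 := (hpos ε h0 h1 i).1.ne'
    have h3 := (hpos ε h0 h1 i).2.ne'
    simp only [hg, ha, hb, Pi.smul_apply, smul_eq_mul]
    field_simp
    ring
  constructor
  · set M : Fin m → ℝ := fun i => ∑ j, (2 / σ i * |Q i j| + 2 / σ j * |Q j i|) with hM
    have hM0 : ∀ i, 0 ≤ M i := fun i => Finset.sum_nonneg fun j _ => by
      have := hσ i
      have := hσ j
      positivity
    set c : Fin m → ℝ := fun i => 4 * |d i| / σ i + 2 * σ i * M i + 1 with hc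
    have hc0 : ∀ i, 0 < c i := fun i => by
      have := hσ i
      have := hM0 i
      positivity
    refine ⟨∑ i, c i, Finset.sum_pos (fun i _ => hc0 i) ⟨⟨0, by omega⟩, Finset.mem_univ _⟩,
      ε₀ / 2, by linarith, by linarith, fun ε h0 h1 i j => ?_⟩
    have hlt : ε < ε₀ := by linarith
    have hoff : ∀ i j, i ≠ j → 0 ≤ Y ε i j := fun i j hij => by
      have := hΨnonneg ε h0 hlt i j
      simp only [hY, Matrix.smul_apply, Matrix.sub_apply, one_apply_ne hij, sub_zero,
        smul_eq_mul]
      positivity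
    have hrow : ∀ i, ∑ j, Y ε i j ≤ 0 := fun i => by
      simp only [hY, Matrix.smul_apply, Matrix.sub_apply, smul_eq_mul, ← Finset.mul_sum,
        Finset.sum_sub_distrib]
      have h2 : ∑ j, (1 : Matrix (Fin m) (Fin m) ℝ) i j = 1 := by simp [one_apply]
      rw [h2]
      exact mul_nonpos_of_nonneg_of_nonpos (by positivity) (by linarith [hΨrow ε h0 hlt i])
    have hΨle : ∀ i j, |Ψ ε i j| ≤ 1 := fun i j => by
      rw [abs_of_nonneg (hΨnonneg ε h0 hlt i j)]
      exact (Finset.single_le_sum (f := fun j => Ψ ε i j)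
        (fun j _ => hΨnonneg ε h0 hlt i j) (Finset.mem_univ j)).trans (hΨrow ε h0 hlt i)
    have hapos : ∀ i, 0 < a ε i := fun i => inv_pos.mpr (hpos ε h0 hlt i).1
    have hbpos : ∀ i, 0 < b ε i := fun i => inv_pos.mpr (hpos ε h0 hlt i).2
    have hale : ∀ i, a ε i ≤ 2 / σ i := fun i => by
      rw [← inv_div]
      exact inv_anti₀ (half_pos (hσ i))
        (by linarith [(hpos (2 * ε) (by linarith) (by linarith) i).1])
    have hble : ∀ i, b ε i ≤ 2 / σ i := fun i => by
      rw [← inv_div]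
      exact inv_anti₀ (half_pos (hσ i))
        (by linarith [(hpos (2 * ε) (by linarith) (by linarith) i).2])
    have hR : |(diagonal (a ε) * Q * Ψ ε + Ψ ε * diagonal (b ε) * Q) i i| ≤ M i := by
      rw [Matrix.add_apply, Matrix.mul_apply, Matrix.mul_apply, ← Finset.sum_add_distrib]
      refine (Finset.abs_sum_le_sum_abs _ _).trans (Finset.sum_le_sum fun k _ => ?_)
      rw [diagonal_mul, mul_diagonal]
      refine (abs_add_le _ _).trans (add_le_add ?_ ?_)
      · rw [abs_mul, abs_mul, abs_of_pos (hapos i)]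
        have := mul_le_mul_of_nonneg_right (hale i) (abs_nonneg (Q i k))
        have h3 := hapos i
        exact (mul_le_of_le_one_right (by positivity) (hΨle k i)).trans this
      · rw [abs_mul, abs_mul, abs_of_pos (hbpos k)]
        have h3 := hbpos k
        refine mul_le_mul_of_nonneg_right ?_ (abs_nonneg _)
        exact (mul_le_of_le_one_left h3.le (hΨle i k)).trans (hble k)
    have hdiag : |Y ε i i| ≤ c i := by
      have hp : 0 ≤ 4 * |d i| / σ i := div_nonneg (by positivity) (hσ i).le
      have hq : 0 ≤ 2 * σ i * M i := mul_nonneg (by linarith [hσ i]) (hM0 i)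
      refine abs_le_of_sq_le_mul_abs_add hp hq ?_
      have h2 := congrFun (congrFun (heq ε h0 hlt) i) i
      rw [add_assoc, Matrix.add_apply, Matrix.add_apply, diagonal_mul, Matrix.zero_apply] at h2
      have h3 := mul_sq_diag_le (fun i => (hbpos i).le) hoff i
      have h4 : -(g ε i * Y ε i i) ≤ b ε i * (4 * |d i| / σ i * |Y ε i i|) := by
        refine (neg_le_abs _).trans ?_
        simp only [hg, abs_mul, abs_of_pos (hapos i), abs_of_pos (hbpos i), abs_two]
        have h5 := mul_le_mul_of_nonneg_left (hale i)
          (show 0 ≤ 2 * |d i| * b ε i * |Y ε i i| from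
            mul_nonneg (mul_nonneg (by positivity) (hbpos i).le) (abs_nonneg _))
        calc _ = 2 * |d i| * b ε i * |Y ε i i| * a ε i := by ring
          _ ≤ _ := h5
          _ = _ := by ring
      have h6 : M i ≤ b ε i * (2 * σ i * M i) := by
        have h7 : 1 ≤ b ε i * (2 * σ i) := by
          simp only [hb]
          rw [inv_mul_eq_div, one_le_div (hpos ε h0 hlt i).2]
          linarith [(hpos ε h0 hlt i).1]
        calc M i = 1 * M i := (one_mul _).symm
          _ ≤ b ε i * (2 * σ i) * M i := mul_le_mul_of_nonneg_right h7 (hM0 i)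
          _ = _ := by ring
      refine le_of_mul_le_mul_left ?_ (hbpos i)
      linarith [neg_le_of_abs_le hR]
    calc |1 / ε * (Ψ ε - 1) i j| = |Y ε i j| := rfl
      _ ≤ |Y ε i i| := abs_apply_le_abs_diag hoff hrow i j
      _ ≤ c i := hdiag
      _ ≤ ∑ i, c i := Finset.single_le_sum (fun i _ => (hc0 i).le) (Finset.mem_univ i)
  · intro e he he0 Ybar hlim
    have hYlim : Tendsto (fun k => Y (e k)) atTop (nhds Ybar) :=
      tendsto_pi_nhds.mpr fun i => tendsto_pi_nhds.mpr fun j => hlim i j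
    have hΨlim : Tendsto (fun k => Ψ (e k)) atTop (nhds 1) := by
      have h := (tendsto_const_nhds (x := (1 : Matrix (Fin m) (Fin m) ℝ))).add (he0.smul hYlim)
      rw [zero_smul, add_zero] at h
      exact h.congr fun k => (hΨY (e k) (he k).1).symm
    have halim : Tendsto (fun k => a (e k)) atTop (nhds fun i => (σ i)⁻¹) :=
      tendsto_pi_nhds.mpr fun i => by
        have h := ((he0.mul_const (d i)).const_add (σ i))
        rw [zero_mul, add_zero] at h
        exact h.inv₀ (hσ i).ne'
    have hblim : Tendsto (fun k => b (e k)) atTop (nhds fun i => (σ i)⁻¹) :=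
      tendsto_pi_nhds.mpr fun i => by
        have h := ((he0.mul_const (d i)).const_sub (σ i))
        rw [zero_mul, sub_zero] at h
        exact h.inv₀ (hσ i).ne'
    have hglim : Tendsto (fun k => g (e k)) atTop
        (nhds fun i => 2 * d i * (σ i)⁻¹ * (σ i)⁻¹) :=
      tendsto_pi_nhds.mpr fun i =>
        ((tendsto_pi_nhds.mp halim i).const_mul _).mul (tendsto_pi_nhds.mp hblim i)
    have hdiag : Continuous (diagonal : (Fin m → ℝ) → Matrix (Fin m) (Fin m) ℝ) :=
      continuous_id.matrix_diagonal
    have hA := (hdiag.tendsto _).comp halim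
    have hB := (hdiag.tendsto _).comp hblim
    have hG := (hdiag.tendsto _).comp hglim
    have hL := ((((hYlim.mul hB).mul hYlim).add (hG.mul hYlim)).add
      ((hA.mul_const Q).mul hΨlim)).add ((hΨlim.mul hB).mul_const Q)
    have hlimeq := tendsto_nhds_unique hL
      (tendsto_const_nhds.congr fun k => (heq (e k) (he k).1 (he k).2).symm)
    rw [mul_one, one_mul] at hlimeq
    have hVinv : (diagonal σ ^ 2)⁻¹ = (diagonal fun i => (σ i)⁻¹) * diagonal fun i => (σ i)⁻¹ := by
      rw [pow_two, Matrix.mul_inv_rev, inv_diagonal_of_pos hσ]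
    rw [hVinv, inv_diagonal_of_pos hσ]
    have hSG : (2 : ℝ) • ((diagonal fun i => (σ i)⁻¹) * (diagonal fun i => (σ i)⁻¹) * diagonal d)
          * (diagonal fun i => (σ i)⁻¹)
        = (diagonal fun i => (σ i)⁻¹) * diagonal fun i => 2 * d i * (σ i)⁻¹ * (σ i)⁻¹ := by
      simp only [diagonal_mul_diagonal, ← diagonal_smul]
      congr 1
      ext i
      simp only [Pi.smul_apply, smul_eq_mul]
      ring
    rw [← mul_assoc _ _ Ybar, hSG, ← mul_zero (diagonal fun i => (σ i)⁻¹), ← hlimeq]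
    simp only [pow_two, mul_add, mul_assoc, two_smul]
    abel
end

section
/- Fix $m \ge 1$, let $Q$ be an $m\times m$ real matrix with nonnegative off-diagonal entries and zero row sums (a generator) which is irreducible, i.e., for all $i \ne j$ there exist indices $i = i_0, i_1, \dots, i_p = j$ with $Q_{i_\ell i_{\ell+1}} > 0$ for each $\ell$. Let $\boldsymbol{\alpha}$ be a stationary row vector of $Q$: $\boldsymbol{\alpha} Q = \boldsymbol{0}$, $\boldsymbol{\alpha} \boldsymbol{1} = 1$, $\boldsymbol{\alpha} \ge \boldsymbol{0}$. Let $D = \mathrm{diag}(\mu_1,\dots,\mu_m)$ be a real diagonal matrix with $\boldsymbol{\alpha} D \boldsymbol{1} < 0$, and let $V = \mathrm{diag}(\sigma_1^2,\dots,\sigma_m^2)$ with all $\sigma_i > 0$. Then the complex polynomial $p(z) = \det(z^2 V + 2 z D + 2Q)$ has degree exactly $2m$, and counting roots in $\mathbb{C}$ with multiplicity: $z = 0$ is a root, exactly $m-1$ roots have strictly negative real part, and exactly $m$ roots have strictly positive real part (so $0$ is a simple root and it is the only root on the imaginary axis). -/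
open Matrix Polynomial

section RootCounting

/-- If a family of complex polynomials of constant degree and leading coefficient depends
continuously on a parameter in a preconnected space, its roots stay bounded, and no root ever lies
on the frontier of `U`, then the number of roots in `U` is constant. -/
theorem card_roots_filter_mem_eq_of_preconnectedSpace {T : Type*} [TopologicalSpace T]
    [PreconnectedSpace T] {p : T → ℂ[X]} {n : ℕ} {L : ℂ} {R : ℝ} {U : Set ℂ}
    [DecidablePred (· ∈ U)] (hL : L ≠ 0) (hdeg : ∀ t, (p t).natDegree = n)
    (hlead : ∀ t, (p t).leadingCoeff = L) (hcont : ∀ w, Continuous fun t => (p t).eval w)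
    (hR : ∀ t w, (p t).eval w = 0 → ‖w‖ ≤ R) (hU : ∀ t, ∀ w ∈ frontier U, (p t).eval w ≠ 0)
    (t₁ t₂ : T) :
    ((p t₁).roots.filter (· ∈ U)).card = ((p t₂).roots.filter (· ∈ U)).card := by
  have hp0 : ∀ t, p t ≠ 0 := fun t h => hL (by rw [← hlead t, h, leadingCoeff_zero])
  let S : Finset (Fin n) → Set (T × (Fin n → Metric.closedBall (0 : ℂ) R)) := fun s =>
    {x | (∀ w, (p x.1).eval w = L * ∏ i, (w - x.2 i)) ∧
      (∀ i ∈ s, (x.2 i : ℂ) ∈ closure U) ∧ ∀ i, i ∉ s → (x.2 i : ℂ) ∈ closure Uᶜ}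
  have hS : ∀ s, IsClosed (Prod.fst '' S s) := by
    intro s
    refine isClosedMap_fst_of_compactSpace _ ?_
    have hz : ∀ i, Continuous fun x : T × (Fin n → Metric.closedBall (0 : ℂ) R) =>
        (x.2 i : ℂ) := fun i => by fun_prop
    simp only [S, Set.ofPred_and, Set.ofPred_forall]
    refine IsClosed.inter (isClosed_iInter fun w => ?_) (IsClosed.inter ?_ ?_)
    · exact isClosed_eq ((hcont w).comp continuous_fst) (by fun_prop)
    · exact isClosed_iInter fun i => isClosed_iInter fun _ => isClosed_closure.preimage (hz i)
    · exact isClosed_iInter fun i => isClosed_iInter fun _ => isClosed_closure.preimage (hz i)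
  have hcount : ∀ t s, t ∈ Prod.fst '' S s → ((p t).roots.filter (· ∈ U)).card = s.card := by
    rintro _ s ⟨⟨t, z⟩, ⟨hz, hin, hout⟩, rfl⟩
    have hpt : p t = C L * (Finset.univ.val.map fun i => X - C (z i : ℂ)).prod := by
      refine Polynomial.funext fun w => ?_
      rw [hz w, eval_mul, eval_C, eval_multiset_prod, Multiset.map_map]
      simp [Finset.prod]
    have hroots : (p t).roots = Finset.univ.val.map fun i => (z i : ℂ) := by
      rw [hpt, roots_C_mul _ hL, ← roots_multiset_prod_X_sub_C
        (Finset.univ.val.map fun i => (z i : ℂ)), Multiset.map_map]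
      rfl
    have hzero : ∀ i, (p t).eval (z i : ℂ) = 0 := fun i => by
      rw [hz, Finset.prod_eq_zero (Finset.mem_univ i) (sub_self _), mul_zero]
    have hmem : ∀ i, (z i : ℂ) ∈ U ↔ i ∈ s := by
      intro i
      refine ⟨fun hi => ?_, fun hi => ?_⟩
      · by_contra his
        refine hU t _ ?_ (hzero i)
        rw [frontier_eq_closure_inter_closure]
        exact ⟨subset_closure hi, hout i his⟩
      · by_contra his
        refine hU t _ ?_ (hzero i)
        rw [frontier_eq_closure_inter_closure]
        exact ⟨hin i hi, subset_closure his⟩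
    rw [hroots, Multiset.filter_map, Multiset.card_map]
    change (Finset.univ.filter fun i => (z i : ℂ) ∈ U).card = _
    congr 1
    ext i
    simp [hmem]
  have hex : ∀ t, ∃ s, t ∈ Prod.fst '' S s := by
    intro t
    have hcard : (p t).roots.toList.length = n := by
      rw [Multiset.length_toList, IsAlgClosed.card_roots_eq_natDegree, hdeg]
    obtain ⟨z, hz⟩ : ∃ z : Fin n → ℂ, (p t).roots = Finset.univ.val.map z := by
      subst hcard
      refine ⟨(p t).roots.toList.get, ?_⟩
      rw [Fin.univ_val_map, List.ofFn_get, Multiset.coe_toList]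
    have hzero : ∀ i, (p t).eval (z i) = 0 := fun i => by
      have : z i ∈ (p t).roots := by
        rw [hz]; exact Multiset.mem_map_of_mem _ (Finset.mem_univ i)
      exact (mem_roots (hp0 t)).1 this
    refine ⟨Finset.univ.filter fun i => z i ∈ U,
      ⟨t, fun i => ⟨z i, by simpa using hR t _ (hzero i)⟩⟩, ⟨fun w => ?_, fun i hi => ?_,
        fun i hi => ?_⟩, rfl⟩
    · rw [(IsAlgClosed.splits (p t)).eval_eq_prod_roots, hlead, hz, Multiset.map_map]
      rfl
    · exact subset_closure (by simpa using hi)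
    · exact subset_closure (by simpa using hi)
  have hconst : Continuous fun t => ((p t).roots.filter (· ∈ U)).card := by
    refine continuous_iff_isClosed.2 fun A _ => ?_
    have : (fun t => ((p t).roots.filter (· ∈ U)).card) ⁻¹' A =
        ⋃ s ∈ {s : Finset (Fin n) | s.card ∈ A}, Prod.fst '' S s := by
      ext t
      simp only [Set.mem_preimage, Set.mem_iUnion₂, Set.mem_ofPred_eq]
      refine ⟨fun ht => ?_, fun ⟨s, hs, hts⟩ => by rwa [hcount t s hts]⟩
      obtain ⟨s, hs⟩ := hex t
      exact ⟨s, by rwa [← hcount t s hs], hs⟩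
    rw [this]
    exact (Set.toFinite _).isClosed_biUnion fun s _ => hS s
  exact (IsLocallyConstant.iff_continuous _ |>.2 hconst).apply_eq_of_preconnectedSpace _ _

/-- A real quadratic with positive leading coefficient which is negative at `x` has exactly one
complex root with real part greater than `x`. -/
theorem card_roots_quadratic_re_gt {a b c x : ℝ} (ha : 0 < a)
    (hx : a * x ^ 2 + b * x + c < 0) :
    ((C (a : ℂ) * X ^ 2 + C (b : ℂ) * X + C (c : ℂ)).roots.filter fun z : ℂ => x < z.re).card
      = 1 := by
  obtain ⟨d, hd0, hd⟩ : ∃ d : ℝ, 0 ≤ d ∧ d ^ 2 = b ^ 2 - 4 * a * c :=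
    ⟨√(b ^ 2 - 4 * a * c), Real.sqrt_nonneg _,
      Real.sq_sqrt (by nlinarith [sq_nonneg (2 * a * x + b)])⟩
  have hlt : |2 * a * x + b| < d := abs_lt_of_sq_lt_sq (by nlinarith) hd0
  obtain ⟨h1, h2⟩ := abs_lt.1 hlt
  set r : ℝ := (-b - d) / (2 * a) with hr
  set s : ℝ := (-b + d) / (2 * a) with hs
  have hrx : r < x := by rw [hr, div_lt_iff₀ (by positivity)]; linarith
  have hxs : x < s := by rw [hs, lt_div_iff₀ (by positivity)]; linarith
  have hsum : a * (r + s) = -b := by rw [hr, hs]; field_simp; ring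
  have hprod : a * (r * s) = c := by
    rw [hr, hs]; field_simp; nlinarith
  have hfac : C (a : ℂ) * X ^ 2 + C (b : ℂ) * X + C (c : ℂ)
      = C (a : ℂ) * ((X - C (r : ℂ)) * (X - C (s : ℂ))) := by
    have hb : (b : ℂ) = -(a * (r + s)) := by exact_mod_cast (by linarith : b = -(a * (r + s)))
    have hc : (c : ℂ) = a * (r * s) := by exact_mod_cast hprod.symm
    rw [hb, hc]
    simp only [map_neg, map_mul, map_add]
    ring
  rw [hfac, roots_C_mul _ (by exact_mod_cast ha.ne'),
    roots_mul (mul_ne_zero (X_sub_C_ne_zero _) (X_sub_C_ne_zero _)), roots_X_sub_C,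
    roots_X_sub_C, Multiset.filter_add, Multiset.filter_singleton, Multiset.filter_singleton]
  simp [hxs, hrx.le]

end RootCounting

section PolynomialMatrix

variable {ι R : Type*} [Fintype ι] [DecidableEq ι] [CommRing R]

theorem natDegree_det_le_card_mul {M : Matrix ι ι R[X]} {n : ℕ}
    (hM : ∀ i j, (M i j).natDegree ≤ n) : M.det.natDegree ≤ Fintype.card ι * n := by
  rw [det_apply]
  refine natDegree_sum_le_of_forall_le _ _ fun τ _ => ?_
  refine (natDegree_smul_le _ _).trans ((natDegree_prod_le _ _).trans ?_)
  calc _ ≤ ∑ _i : ι, n := Finset.sum_le_sum fun i _ => hM _ _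
    _ = _ := by simp

theorem coeff_det_card_mul {M : Matrix ι ι R[X]} {n : ℕ}
    (hM : ∀ i j, (M i j).natDegree ≤ n) :
    M.det.coeff (Fintype.card ι * n) = (of fun i j => (M i j).coeff n).det := by
  rw [det_apply, det_apply, finsetSum_coeff]
  refine Finset.sum_congr rfl fun τ _ => ?_
  rw [coeff_smul, Fintype.card, coeff_prod_of_natDegree_le _ _ n fun i _ => hM _ _]
  rfl

end PolynomialMatrix

section Dominance

variable {ι : Type*} [Fintype ι] [DecidableEq ι]

/-- Weighted strict row diagonal dominance implies nonsingularity. -/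
theorem det_ne_zero_of_weighted_sum_row_lt_diag {A : Matrix ι ι ℂ} {h : ι → ℝ}
    (hpos : ∀ i, 0 < h i)
    (hA : ∀ i, ∑ j ∈ Finset.univ.erase i, ‖A i j‖ * h j < ‖A i i‖ * h i) : A.det ≠ 0 := by
  have : (A * diagonal fun i => (h i : ℂ)).det ≠ 0 := by
    refine det_ne_zero_of_sum_row_lt_diag fun i => ?_
    simpa [mul_diagonal, abs_of_pos (hpos _)] using hA i
  rw [det_mul] at this
  exact left_ne_zero_of_mul this

end Dominance

section Generator

variable {ι : Type*} [Fintype ι]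

/-- Maximum principle: the kernel of an irreducible generator consists of constant vectors. -/
theorem eq_of_irreducible_generator_mulVec_eq_zero {Q : Matrix ι ι ℝ}
    (hoff : ∀ i j, i ≠ j → 0 ≤ Q i j) (hrow : ∀ i, ∑ j, Q i j = 0)
    (hirr : ∀ i j, i ≠ j → Relation.TransGen (fun a b => 0 < Q a b) i j)
    {w : ι → ℝ} (hw : Q *ᵥ w = 0) (i j : ι) : w i = w j := by
  have : Nonempty ι := ⟨i⟩
  obtain ⟨k, hk⟩ := Finite.exists_max w
  have step : ∀ a b, w a = w k → 0 < Q a b → w b = w k := by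
    intro a b ha hab
    have hterm : ∀ l ∈ Finset.univ, 0 ≤ Q a l * (w a - w l) := by
      intro l _
      rcases eq_or_ne a l with rfl | hal
      · simp
      · exact mul_nonneg (hoff a l hal) (by linarith [hk l])
    have hsum : ∑ l, Q a l * (w a - w l) = 0 := by
      have : ∑ l, Q a l * w l = 0 := congrFun hw a
      simp [mul_sub, ← Finset.sum_mul, hrow, this]
    have := (Finset.sum_eq_zero_iff_of_nonneg hterm).1 hsum b (Finset.mem_univ b)
    have := (mul_eq_zero.1 this).resolve_left hab.ne'
    linarith
  have hall : ∀ l, w l = w k := by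
    intro l
    rcases eq_or_ne k l with rfl | hkl
    · rfl
    · have := hirr k l hkl
      induction this with
      | single h => exact step _ _ rfl h
      | @tail b c hb hbc ih =>
        rcases eq_or_ne k b with rfl | hkb
        · exact step _ _ rfl hbc
        · exact step _ _ (ih hkb) hbc
  rw [hall i, hall j]

variable [DecidableEq ι]

theorem mulVec_updateCol_apply {Q : Matrix ι ι ℝ} (k : ι) (μ w : ι → ℝ) :
    Q.updateCol k μ *ᵥ w = Q *ᵥ Function.update w k 0 + w k • μ := by
  ext i
  simp only [mulVec, dotProduct, Pi.add_apply, Pi.smul_apply, smul_eq_mul]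
  rw [← Finset.add_sum_erase _ _ (Finset.mem_univ k),
    ← Finset.add_sum_erase _ (fun j => Q i j * Function.update w k 0 j) (Finset.mem_univ k)]
  have : ∑ j ∈ Finset.univ.erase k, Q.updateCol k μ i j * w j
      = ∑ j ∈ Finset.univ.erase k, Q i j * Function.update w k 0 j :=
    Finset.sum_congr rfl fun j hj => by
      rw [updateCol_ne (Finset.ne_of_mem_erase hj),
        Function.update_of_ne (Finset.ne_of_mem_erase hj)]
  rw [this]
  simp
  ring

/-- Replacing a column of an irreducible generator by a drift vector with nonzero stationary mean
gives a nonsingular matrix. -/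
theorem det_updateCol_ne_zero_of_irreducible_generator {Q : Matrix ι ι ℝ}
    (hoff : ∀ i j, i ≠ j → 0 ≤ Q i j) (hrow : ∀ i, ∑ j, Q i j = 0)
    (hirr : ∀ i j, i ≠ j → Relation.TransGen (fun a b => 0 < Q a b) i j)
    {α μ : ι → ℝ} (hα : α ᵥ* Q = 0) (hμ : α ⬝ᵥ μ ≠ 0) (k : ι) :
    (Q.updateCol k μ).det ≠ 0 := by
  intro hdet
  obtain ⟨w, hw0, hw⟩ := exists_mulVec_eq_zero_iff.2 hdet
  rw [mulVec_updateCol_apply] at hw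
  have hdot := congrArg (α ⬝ᵥ ·) hw
  simp only [dotProduct_add, dotProduct_mulVec, hα, zero_dotProduct, dotProduct_smul,
    dotProduct_zero, zero_add, smul_eq_mul] at hdot
  have hwk : w k = 0 := (mul_eq_zero.1 hdot).resolve_right hμ
  rw [hwk, zero_smul, add_zero, Function.update_eq_self_iff.2 hwk.symm] at hw
  refine hw0 (funext fun i => ?_)
  rw [eq_of_irreducible_generator_mulVec_eq_zero hoff hrow hirr hw i k, hwk, Pi.zero_apply]

/-- The Poisson equation `Q v + μ = -c` has a solution with `c > 0` when the drift `μ` has negative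
stationary mean. -/
theorem exists_mulVec_add_eq_neg_of_drift_neg [Nonempty ι] {Q : Matrix ι ι ℝ}
    (hoff : ∀ i j, i ≠ j → 0 ≤ Q i j) (hrow : ∀ i, ∑ j, Q i j = 0)
    (hirr : ∀ i j, i ≠ j → Relation.TransGen (fun a b => 0 < Q a b) i j)
    {α μ : ι → ℝ} (hα : α ᵥ* Q = 0) (hα1 : ∑ i, α i = 1) (hμ : α ⬝ᵥ μ < 0) :
    ∃ (v : ι → ℝ) (c : ℝ), 0 < c ∧ ∀ i, (Q *ᵥ v) i + μ i = -c := by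
  let k : ι := Classical.arbitrary ι
  have hdet := det_updateCol_ne_zero_of_irreducible_generator hoff hrow hirr hα hμ.ne k
  let w : ι → ℝ := (Q.updateCol k μ)⁻¹ *ᵥ fun _ => -1
  have hw : Q.updateCol k μ *ᵥ w = fun _ => -1 := by
    rw [mulVec_mulVec, mul_nonsing_inv _ (isUnit_iff_ne_zero.2 hdet), one_mulVec]
  rw [mulVec_updateCol_apply] at hw
  have hdot := congrArg (α ⬝ᵥ ·) hw
  simp only [dotProduct_add, dotProduct_mulVec, hα, zero_dotProduct, dotProduct_smul,
    zero_add, smul_eq_mul] at hdot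
  have hsum : (α ⬝ᵥ fun _ => (-1 : ℝ)) = -1 := by simp [dotProduct, hα1]
  rw [hsum] at hdot
  have hwk : 0 < w k := by nlinarith
  refine ⟨(w k)⁻¹ • Function.update w k 0, (w k)⁻¹, inv_pos.2 hwk, fun i => ?_⟩
  have := congrFun hw i
  simp only [Pi.add_apply, Pi.smul_apply, smul_eq_mul] at this
  rw [mulVec_smul, Pi.smul_apply, smul_eq_mul]
  field_simp
  linarith

end Generator

section FluidMatrix

variable {ι : Type*} [DecidableEq ι]

/-- The quadratic matrix polynomial `z² V + 2 z D + 2 Q` with `V = diag (σ²)`, `D = diag μ`. -/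
noncomputable def fluidMatrix (Q : Matrix ι ι ℝ) (μ σ : ι → ℝ) : Matrix ι ι ℂ[X] :=
  (X ^ 2 : ℂ[X]) • (diagonal fun i => C ((σ i : ℂ) ^ 2))
    + (2 * X : ℂ[X]) • (diagonal fun i => C ((μ i : ℂ)))
    + Matrix.map Q fun q : ℝ => C (2 * (q : ℂ))

variable {Q : Matrix ι ι ℝ} {μ σ : ι → ℝ}

theorem fluidMatrix_apply_self (i : ι) : fluidMatrix Q μ σ i i =
    C ((σ i ^ 2 : ℝ) : ℂ) * X ^ 2 + C ((2 * μ i : ℝ) : ℂ) * X + C ((2 * Q i i : ℝ) : ℂ) := by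
  simp [fluidMatrix]
  rw [map_ofNat]
  ring

theorem fluidMatrix_apply_ne {i j : ι} (hij : i ≠ j) :
    fluidMatrix Q μ σ i j = C ((2 * Q i j : ℝ) : ℂ) := by
  simp [fluidMatrix, hij]

theorem natDegree_fluidMatrix_apply_le (i j : ι) : (fluidMatrix Q μ σ i j).natDegree ≤ 2 := by
  rcases eq_or_ne i j with rfl | hij
  · rw [fluidMatrix_apply_self]
    exact natDegree_quadratic_le
  · rw [fluidMatrix_apply_ne hij, natDegree_C]
    exact Nat.zero_le _

variable [Fintype ι]

theorem coeff_det_fluidMatrix :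
    (fluidMatrix Q μ σ).det.coeff (Fintype.card ι * 2) = ∏ i, (σ i : ℂ) ^ 2 := by
  rw [coeff_det_card_mul natDegree_fluidMatrix_apply_le, ← det_diagonal]
  congr 1
  ext i j
  rcases eq_or_ne i j with rfl | hij
  · simp [fluidMatrix_apply_self, -map_pow]
  · simp [fluidMatrix_apply_ne hij, hij]

theorem natDegree_det_fluidMatrix (hσ : ∀ i, 0 < σ i) :
    (fluidMatrix Q μ σ).det.natDegree = Fintype.card ι * 2 :=
  natDegree_eq_of_le_of_coeff_ne_zero (natDegree_det_le_card_mul natDegree_fluidMatrix_apply_le)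
    (by
      rw [coeff_det_fluidMatrix]
      exact Finset.prod_ne_zero_iff.2 fun i _ => pow_ne_zero _ (by exact_mod_cast (hσ i).ne'))

theorem leadingCoeff_det_fluidMatrix (hσ : ∀ i, 0 < σ i) :
    (fluidMatrix Q μ σ).det.leadingCoeff = ∏ i, (σ i : ℂ) ^ 2 := by
  rw [leadingCoeff, natDegree_det_fluidMatrix hσ, coeff_det_fluidMatrix]

theorem eval_det_fluidMatrix (w : ℂ) :
    (fluidMatrix Q μ σ).det.eval w = ((fluidMatrix Q μ σ).map (eval w)).det := by
  simpa using (RingHom.map_det (evalRingHom w) (fluidMatrix Q μ σ))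

/-- If `h > 0` and `(Re (z²) V + 2 Re z D + 2 Q) h < 0`, then `z` is not a root of the fluid
polynomial. -/
theorem eval_det_fluidMatrix_ne_zero (hoff : ∀ i j, i ≠ j → 0 ≤ Q i j) {h : ι → ℝ}
    (hpos : ∀ i, 0 < h i) {w : ℂ}
    (hw : ∀ i, ((w ^ 2).re * σ i ^ 2 + 2 * w.re * μ i) * h i + 2 * ∑ j, Q i j * h j < 0) :
    (fluidMatrix Q μ σ).det.eval w ≠ 0 := by
  rw [eval_det_fluidMatrix]
  refine det_ne_zero_of_weighted_sum_row_lt_diag hpos fun i => ?_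
  have hoffsum : ∑ j ∈ Finset.univ.erase i, ‖(fluidMatrix Q μ σ).map (eval w) i j‖ * h j
      = 2 * ∑ j ∈ Finset.univ.erase i, Q i j * h j := by
    rw [Finset.mul_sum]
    refine Finset.sum_congr rfl fun j hj => ?_
    have hij : i ≠ j := (Finset.ne_of_mem_erase hj).symm
    rw [map_apply, fluidMatrix_apply_ne hij, eval_C, Complex.norm_real, Real.norm_eq_abs,
      abs_of_nonneg (by have := hoff i j hij; positivity)]
    ring
  have hdiag : ((w ^ 2).re * σ i ^ 2 + 2 * w.re * μ i) + 2 * Q i i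
      = ((fluidMatrix Q μ σ).map (eval w) i i).re := by
    rw [map_apply, fluidMatrix_apply_self]
    simp only [eval_add, eval_mul, eval_C, eval_pow, eval_X, Complex.add_re,
      Complex.re_ofReal_mul, Complex.ofReal_re]
    ring
  have hre := (neg_le_abs _).trans
    (Complex.abs_re_le_norm ((fluidMatrix Q μ σ).map (eval w) i i))
  rw [← hdiag] at hre
  have hwi := hw i
  rw [← Finset.add_sum_erase _ _ (Finset.mem_univ i)] at hwi
  rw [hoffsum]
  nlinarith [mul_le_mul_of_nonneg_right hre (hpos i).le]

/-- An a priori bound on the roots of the fluid polynomial. -/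
theorem norm_le_of_eval_det_fluidMatrix_eq_zero (hσ : ∀ i, 0 < σ i) {B : Matrix ι ι ℝ}
    (hB : ∀ i j, |Q i j| ≤ B i j) {w : ℂ} (hw : (fluidMatrix Q μ σ).det.eval w = 0) :
    ‖w‖ ≤ 1 + ∑ i, (2 * |μ i| + 2 * ∑ j, B i j) / σ i ^ 2 := by
  contrapose! hw
  have hB0 : ∀ i j, 0 ≤ B i j := fun i j => (abs_nonneg _).trans (hB i j)
  have hterm : ∀ i, 0 ≤ (2 * |μ i| + 2 * ∑ j, B i j) / σ i ^ 2 := fun i =>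
    div_nonneg (add_nonneg (by positivity)
      (mul_nonneg zero_le_two (Finset.sum_nonneg fun j _ => hB0 i j))) (by positivity)
  rw [eval_det_fluidMatrix]
  refine det_ne_zero_of_weighted_sum_row_lt_diag (h := fun _ => 1) (fun _ => one_pos) fun i => ?_
  have h1 : 1 < ‖w‖ := by linarith [Finset.sum_nonneg fun i (_ : i ∈ Finset.univ) => hterm i]
  have h2 : (2 * |μ i| + 2 * ∑ j, B i j) / σ i ^ 2 < ‖w‖ := by
    linarith [Finset.single_le_sum (fun i _ => hterm i) (Finset.mem_univ i)]
  rw [div_lt_iff₀ (pow_pos (hσ i) 2)] at h2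
  have hoffsum : ∑ j ∈ Finset.univ.erase i, ‖(fluidMatrix Q μ σ).map (eval w) i j‖ * 1
      ≤ 2 * ∑ j ∈ Finset.univ.erase i, B i j := by
    rw [Finset.mul_sum]
    refine Finset.sum_le_sum fun j hj => ?_
    have hij : i ≠ j := (Finset.ne_of_mem_erase hj).symm
    rw [map_apply, fluidMatrix_apply_ne hij, eval_C, Complex.norm_real, Real.norm_eq_abs,
      abs_mul, abs_two]
    linarith [hB i j]
  have hdiag : σ i ^ 2 * ‖w‖ ^ 2 - 2 * |μ i| * ‖w‖ - 2 * B i i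
      ≤ ‖(fluidMatrix Q μ σ).map (eval w) i i‖ := by
    rw [map_apply, fluidMatrix_apply_self]
    simp only [eval_add, eval_mul, eval_C, eval_pow, eval_X]
    have e1 : ‖((σ i ^ 2 : ℝ) : ℂ) * w ^ 2‖ = σ i ^ 2 * ‖w‖ ^ 2 := by
      rw [norm_mul, norm_pow, Complex.norm_real, Real.norm_of_nonneg (sq_nonneg _)]
    have e2 : ‖((2 * μ i : ℝ) : ℂ) * w‖ = 2 * |μ i| * ‖w‖ := by
      rw [norm_mul, Complex.norm_real, Real.norm_eq_abs, abs_mul, abs_two]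
    have e3 : ‖((2 * Q i i : ℝ) : ℂ)‖ = 2 * |Q i i| := by
      rw [Complex.norm_real, Real.norm_eq_abs, abs_mul, abs_two]
    have t1 := norm_sub_le_norm_add (((σ i ^ 2 : ℝ) : ℂ) * w ^ 2 + ((2 * μ i : ℝ) : ℂ) * w)
      ((2 * Q i i : ℝ) : ℂ)
    have t2 := norm_sub_le_norm_add (((σ i ^ 2 : ℝ) : ℂ) * w ^ 2) (((2 * μ i : ℝ) : ℂ) * w)
    linarith [hB i i]
  have hsplit := Finset.add_sum_erase _ (fun j => B i j) (Finset.mem_univ i)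
  have hSnn : 0 ≤ ∑ j, B i j := Finset.sum_nonneg fun j _ => hB0 i j
  have h3 := mul_lt_mul_of_pos_right h2 (zero_lt_one.trans h1)
  have h4 := mul_le_mul_of_nonneg_left h1.le hSnn
  nlinarith

/-- On a line `Re z = x` along which weighted diagonal dominance holds, the fluid polynomial has
exactly as many roots to the right of the line as the matrix has rows. -/
theorem card_roots_det_fluidMatrix_re_gt (hσ : ∀ i, 0 < σ i)
    (hoff : ∀ i j, i ≠ j → 0 ≤ Q i j) {h : ι → ℝ} (hpos : ∀ i, 0 < h i) {x : ℝ}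
    (hx : ∀ i, (x ^ 2 * σ i ^ 2 + 2 * x * μ i) * h i + 2 * ∑ j, Q i j * h j < 0) :
    ((fluidMatrix Q μ σ).det.roots.filter fun z : ℂ => x < z.re).card = Fintype.card ι := by
  let P : unitInterval → Matrix ι ι ℝ := fun t =>
    of fun i j => if i = j then Q i j else (t : ℝ) * Q i j
  have hPdiag : ∀ t i, P t i i = Q i i := fun t i => by simp [P]
  have hPne : ∀ t i j, i ≠ j → P t i j = t * Q i j := fun t i j hij => by simp [P, hij]
  have hPoff : ∀ t i j, i ≠ j → 0 ≤ P t i j := fun t i j hij => by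
    rw [hPne t i j hij]; exact mul_nonneg t.2.1 (hoff i j hij)
  have hPle : ∀ t i j, P t i j ≤ Q i j := fun t i j => by
    rcases eq_or_ne i j with rfl | hij
    · rw [hPdiag]
    · rw [hPne t i j hij]; exact mul_le_of_le_one_left (hoff i j hij) t.2.2
  have hPabs : ∀ t i j, |P t i j| ≤ |Q i j| := fun t i j => by
    rcases eq_or_ne i j with rfl | hij
    · rw [hPdiag]
    · rw [abs_of_nonneg (hPoff t i j hij), abs_of_nonneg (hoff i j hij)]; exact hPle t i j
  have hP1 : P 1 = Q := by ext i j; simp [P]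
  have hPdom : ∀ t i,
      (x ^ 2 * σ i ^ 2 + 2 * x * μ i) * h i + 2 * ∑ j, P t i j * h j < 0 := fun t i => by
    have := Finset.sum_le_sum fun j (_ : j ∈ Finset.univ) =>
      mul_le_mul_of_nonneg_right (hPle t i j) (hpos j).le
    linarith [hx i]
  have hcont : ∀ w, Continuous fun t => (fluidMatrix (P t) μ σ).det.eval w := by
    intro w
    simp only [eval_det_fluidMatrix]
    refine Continuous.matrix_det (continuous_matrix fun i j => ?_)
    simp only [map_apply]
    rcases eq_or_ne i j with rfl | hij
    · simp only [fluidMatrix_apply_self, hPdiag]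
      exact continuous_const
    · simp only [fluidMatrix_apply_ne hij, hPne _ _ _ hij, eval_C]
      fun_prop
  have hline : ∀ t, ∀ w ∈ frontier {z : ℂ | x < z.re},
      (fluidMatrix (P t) μ σ).det.eval w ≠ 0 := by
    intro t w hw
    rw [Complex.frontier_setOfPred_lt_re] at hw
    have hwx : w.re = x := hw
    refine eval_det_fluidMatrix_ne_zero (hPoff t) hpos fun i => ?_
    have hsq : (w ^ 2).re ≤ x ^ 2 := by
      rw [sq, Complex.mul_re, hwx]; nlinarith [sq_nonneg w.im]
    rw [hwx]
    nlinarith [hPdom t i, mul_le_mul_of_nonneg_right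
      (mul_le_mul_of_nonneg_right hsq (sq_nonneg (σ i))) (hpos i).le]
  classical
  have key := card_roots_filter_mem_eq_of_preconnectedSpace
    (p := fun t => (fluidMatrix (P t) μ σ).det) (U := {z : ℂ | x < z.re})
    (Finset.prod_ne_zero_iff.2 fun i _ => pow_ne_zero 2
      (Complex.ofReal_ne_zero.2 (hσ i).ne'))
    (fun t => natDegree_det_fluidMatrix hσ) (fun t => leadingCoeff_det_fluidMatrix hσ) hcont
    (fun t w hw => norm_le_of_eval_det_fluidMatrix_eq_zero hσ (B := Q.map abs) (hPabs t) hw)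
    hline 1 0
  simp only [Set.mem_ofPred_eq, hP1] at key
  have hdet0 : (fluidMatrix (P 0) μ σ).det = ∏ i, fluidMatrix (P 0) μ σ i i := by
    rw [← det_diagonal]
    congr 1
    ext1 i j
    rcases eq_or_ne i j with rfl | hij
    · simp
    · simp [fluidMatrix_apply_ne hij, hij, hPne]
  have hquad : ∀ i, ((fluidMatrix (P 0) μ σ i i).roots.filter fun z : ℂ => x < z.re).card = 1 := by
    intro i
    rw [fluidMatrix_apply_self]
    refine card_roots_quadratic_re_gt (pow_pos (hσ i) 2) ?_
    have hs : ∑ j, P 0 i j * h j = Q i i * h i := by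
      rw [Finset.sum_eq_single i _ (by simp), hPdiag]
      intro j _ hj
      simp [hPne 0 i j hj.symm]
    have := hPdom 0 i
    rw [hs] at this
    rw [hPdiag]
    by_contra hcon
    nlinarith [mul_nonneg (not_lt.1 hcon) (hpos i).le]
  have hne : ∏ i, fluidMatrix (P 0) μ σ i i ≠ 0 := by
    refine Finset.prod_ne_zero_iff.2 fun i _ hi => ?_
    simpa [hi] using hquad i
  rw [key, hdet0, roots_prod _ _ hne, Multiset.filter_bind, Multiset.card_bind]
  simp [hquad]

/-- When `Q` has zero row sums, `z = 0` is a root of the fluid polynomial, and the cofactor is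
expressed by replacing a column of `Q` with the drift vector. -/
theorem exists_det_fluidMatrix_eq_X_mul (hrow : ∀ i, ∑ j, Q i j = 0) (k : ι) :
    ∃ r : ℂ[X], (fluidMatrix Q μ σ).det = X * r ∧
      r.eval 0 = (((2 : ℝ) • Q.updateCol k μ).det : ℂ) := by
  let u : ι → ℂ[X] := fun i => C ((σ i : ℂ) ^ 2) * X + C ((2 * μ i : ℝ) : ℂ)
  refine ⟨((fluidMatrix Q μ σ).updateCol k u).det, ?_, ?_⟩
  · have hsum := det_updateCol_sum (fluidMatrix Q μ σ) k 1
    rw [Pi.one_apply, one_smul] at hsum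
    rw [← hsum, ← det_updateCol_smul]
    congr 2
    ext1 i
    have h0 : ∑ j, (Q i j : ℂ) = 0 := by exact_mod_cast hrow i
    simp only [fluidMatrix, Pi.one_apply, Matrix.add_apply, Matrix.smul_apply,
      map_apply, diagonal_apply, Finset.sum_add_distrib, smul_eq_mul, mul_ite, mul_zero,
      Finset.sum_ite_eq, Finset.mem_univ, if_true, ← map_sum, ← Finset.mul_sum, h0, map_zero,
      Pi.smul_apply, u]
    push_cast
    simp only [map_mul, map_ofNat]
    ring
  · have h1 := RingHom.map_det (evalRingHom (0 : ℂ)) ((fluidMatrix Q μ σ).updateCol k u)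
    have h2 := RingHom.map_det Complex.ofRealHom ((2 : ℝ) • Q.updateCol k μ)
    rw [coe_evalRingHom] at h1
    rw [h1]
    refine Eq.trans ?_ h2.symm
    congr 1
    ext i j
    rcases eq_or_ne j k with rfl | hj
    · simp [u]
    · rcases eq_or_ne i j with rfl | hij
      · simp [hj, fluidMatrix_apply_self]
      · simp [hj, fluidMatrix_apply_ne hij]

end FluidMatrix


/-- Proposition A.4: under the stability assumption `α D 1 < 0`, the polynomial
`det(z²V + 2zD + 2Q)` has degree `2m`, a root at `0`, exactly `m-1` roots with
strictly negative real part, exactly `m` roots with strictly positive real part;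
hence `0` is a simple root and the only root on the imaginary axis. -/
theorem root_splitting_of_fluid_polynomial {m : ℕ} (hm : 1 ≤ m)
    (Q : Matrix (Fin m) (Fin m) ℝ)
    (hQoff : ∀ i j : Fin m, i ≠ j → 0 ≤ Q i j)
    (hQrow : ∀ i : Fin m, ∑ j, Q i j = 0)
    (hirr : ∀ i j : Fin m, i ≠ j → Relation.TransGen (fun a b : Fin m => 0 < Q a b) i j)
    (α : Fin m → ℝ) (hαnonneg : ∀ i, 0 ≤ α i)
    (hαQ : Matrix.vecMul α Q = 0) (hαsum : ∑ i, α i = 1)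
    (μ σ : Fin m → ℝ) (hσ : ∀ i, 0 < σ i)
    (hdrift : ∑ i, α i * μ i < 0)
    (p : Polynomial ℂ)
    (hp : p = Matrix.det
      ((Polynomial.X ^ 2 : Polynomial ℂ) • (Matrix.diagonal fun i : Fin m => Polynomial.C ((σ i : ℂ) ^ 2))
        + (2 * Polynomial.X : Polynomial ℂ) • (Matrix.diagonal fun i : Fin m => Polynomial.C ((μ i : ℂ)))
        + Matrix.map Q fun q : ℝ => Polynomial.C (2 * (q : ℂ)))) :
    p.degree = (2 * m : ℕ)
      ∧ p.eval 0 = 0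
      ∧ (p.roots.filter fun z : ℂ => z.re < 0).card = m - 1
      ∧ (p.roots.filter fun z : ℂ => 0 < z.re).card = m
      ∧ p.rootMultiplicity 0 = 1
      ∧ (p.roots.filter fun z : ℂ => z.re = 0).card = 1 := by
  have : Nonempty (Fin m) := ⟨⟨0, hm⟩⟩
  let k : Fin m := ⟨0, hm⟩
  have hpM : p = (fluidMatrix Q μ σ).det := hp
  have hdeg : p.natDegree = 2 * m := by
    rw [hpM, natDegree_det_fluidMatrix hσ, Fintype.card_fin, mul_comm]
  have hp0 : p ≠ 0 := fun h => by
    rw [h, natDegree_zero] at hdeg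
    omega
  have hcard : p.roots.card = 2 * m := by rw [IsAlgClosed.card_roots_eq_natDegree, hdeg]
  obtain ⟨r, hr, hr0⟩ := exists_det_fluidMatrix_eq_X_mul (μ := μ) (σ := σ) hQrow k
  rw [← hpM] at hr
  have hr0' : r.eval 0 ≠ 0 := by
    rw [hr0, Complex.ofReal_ne_zero, det_smul]
    exact mul_ne_zero (by positivity)
      (det_updateCol_ne_zero_of_irreducible_generator hQoff hQrow hirr hαQ hdrift.ne k)
  have hmult : p.rootMultiplicity 0 = 1 := by
    have hX : rootMultiplicity 0 (X : ℂ[X]) = 1 := by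
      simpa using rootMultiplicity_X_sub_C_self (x := (0 : ℂ))
    rw [hr, rootMultiplicity_mul (hr ▸ hp0), hX, rootMultiplicity_eq_zero hr0']
  have haxis : ∀ z : ℂ, z ∈ p.roots → z.re = 0 → z = 0 := by
    intro z hz hre
    by_contra hz0
    have him : z.im ≠ 0 := fun h => hz0 (Complex.ext hre h)
    refine eval_det_fluidMatrix_ne_zero (μ := μ) (σ := σ) hQoff (h := fun _ => 1)
      (fun _ => one_pos) (w := z) (fun i => ?_) (hpM ▸ (mem_roots hp0).1 hz)
    have hzsq : (z ^ 2).re = -z.im ^ 2 := by rw [sq, Complex.mul_re, hre]; ring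
    simp only [mul_one, hQrow, hzsq, hre]
    have := mul_pos (pow_pos (hσ i) 2) (pow_pos (abs_pos.2 him) 2)
    rw [sq_abs] at this
    linarith
  have hzero : (p.roots.filter fun z : ℂ => z.re = 0).card = 1 := by
    rw [← hmult, ← count_roots, Multiset.count, Multiset.countP_eq_card_filter]
    congr 1
    refine Multiset.filter_congr fun z hz => ⟨fun h => (haxis z hz h).symm, fun h => ?_⟩
    rw [← h, Complex.zero_re]
  obtain ⟨v, c, hc, hv⟩ := exists_mulVec_add_eq_neg_of_drift_neg hQoff hQrow hirr hαQ hαsum hdrift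
  have hpositive : (p.roots.filter fun z : ℂ => 0 < z.re).card = m := by
    have hpos : ∀ᶠ x : ℝ in nhdsWithin 0 (Set.Ioi 0), ∀ i, 0 < 1 + x * v i := by
      refine Filter.eventually_all.2 fun i => nhdsWithin_le_nhds ?_
      have hc : Continuous fun x : ℝ => 1 + x * v i := by fun_prop
      exact hc.continuousAt.eventually_const_lt (by simp)
    have hdom : ∀ᶠ x : ℝ in nhdsWithin 0 (Set.Ioi 0), ∀ i,
        -2 * c + x * (σ i ^ 2 * (1 + x * v i) + 2 * μ i * v i) < 0 := by
      refine Filter.eventually_all.2 fun i => nhdsWithin_le_nhds ?_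
      have hct : Continuous fun x : ℝ =>
        -2 * c + x * (σ i ^ 2 * (1 + x * v i) + 2 * μ i * v i) := by fun_prop
      exact hct.continuousAt.eventually_lt_const (by simpa using hc)
    have hroots : ∀ᶠ x : ℝ in nhdsWithin 0 (Set.Ioi 0), ∀ z ∈ p.roots.toFinset,
        0 < z.re → x < z.re := by
      refine (Filter.eventually_all_finset _).2 fun z _ => ?_
      by_cases hz : 0 < z.re
      · exact nhdsWithin_le_nhds ((eventually_lt_nhds hz).mono fun x hx _ => hx)
      · exact Filter.Eventually.of_forall fun x h => absurd h hz
    obtain ⟨x, hxpos, hxdom, hxroots, hx⟩ :=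
      (hpos.and (hdom.and (hroots.and self_mem_nhdsWithin))).exists
    have hx0 : 0 < x := hx
    have hcount := card_roots_det_fluidMatrix_re_gt (μ := μ) hσ hQoff hxpos (x := x) fun i => ?_
    · rw [← hpM, Fintype.card_fin] at hcount
      rw [← hcount]
      congr 1
      exact Multiset.filter_congr fun z hz =>
        ⟨hxroots z (Multiset.mem_toFinset.2 hz), hx0.trans⟩
    · have hQh : ∑ j, Q i j * (1 + x * v j) = x * (-c - μ i) := by
        have hvi : ∑ j, Q i j * v j + μ i = -c := hv i
        simp only [mul_add, mul_one, Finset.sum_add_distrib, hQrow, zero_add,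
          mul_left_comm _ x, ← Finset.mul_sum]
        rw [← hvi]
        ring
      rw [hQh]
      nlinarith [mul_neg_of_pos_of_neg hx0 (hxdom i)]
  have hnegative : (p.roots.filter fun z : ℂ => z.re < 0).card = m - 1 := by
    have h1 := congrArg Multiset.card
      (Multiset.filter_add_not (fun z : ℂ => z.re < 0) p.roots)
    have h2 := congrArg Multiset.card (Multiset.filter_add_not (fun z : ℂ => z.re = 0)
      (p.roots.filter fun z : ℂ => ¬ z.re < 0))
    rw [Multiset.filter_filter, Multiset.filter_filter] at h2
    have e1 : (p.roots.filter fun z : ℂ => z.re = 0 ∧ ¬ z.re < 0)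
        = p.roots.filter fun z : ℂ => z.re = 0 :=
      Multiset.filter_congr fun z _ => ⟨And.left, fun h => ⟨h, h.not_lt⟩⟩
    have e2 : (p.roots.filter fun z : ℂ => ¬ z.re = 0 ∧ ¬ z.re < 0)
        = p.roots.filter fun z : ℂ => 0 < z.re :=
      Multiset.filter_congr fun z _ =>
        ⟨fun h => lt_of_le_of_ne (not_lt.1 h.2) (Ne.symm h.1), fun h => ⟨h.ne', h.not_gt⟩⟩
    rw [e1, e2] at h2
    simp only [Multiset.card_add] at h1 h2
    omega
  refine ⟨?_, ?_, hnegative, hpositive, hmult, hzero⟩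
  · rw [degree_eq_natDegree hp0, hdeg]
  · rw [hr, eval_mul, eval_X, zero_mul]
end

section
/- Let $\Theta = \mathrm{diag}(\sigma_1,\dots,\sigma_m)$ be a diagonal real matrix with all $\sigma_i > 0$, set $V = \Theta^2$, let $D$ be a real diagonal matrix, let $Q$ be an $m\times m$ real matrix, and let $\boldsymbol{\alpha}$ be a row vector with $\boldsymbol{\alpha} Q = \boldsymbol{0}$. Suppose $Y$ is an $m\times m$ real matrix satisfying $Y^2 + 2V^{-1}D\,Y + 2V^{-1}Q = 0$, and set $\Psi_1 = \Theta Y$ and $\boldsymbol{\zeta}_1 = -\boldsymbol{\alpha}\left( \Theta^{-1}D + (1/2)\,\Theta\, \Psi_1\, \Theta^{-1} \right)$. Then $\boldsymbol{\zeta}_1 \Psi_1 = \boldsymbol{0}$. -/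
open Matrix

/-- The vector `ζ₁ = -α(Θ⁻¹D + (1/2)ΘΨ₁Θ⁻¹)` annihilates `Ψ₁ = ΘY`, where `Y`
solves `Y² + 2V⁻¹DY + 2V⁻¹Q = 0` and `αQ = 0` (equation (3.6) of the paper). -/
theorem zeta1_annihilates_Psi1 {m : ℕ}
    (σ d : Fin m → ℝ) (hσ : ∀ i, 0 < σ i)
    (Θ D V : Matrix (Fin m) (Fin m) ℝ)
    (hΘ : Θ = Matrix.diagonal σ) (hD : D = Matrix.diagonal d) (hV : V = Θ ^ 2)
    (Q : Matrix (Fin m) (Fin m) ℝ)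
    (α : Fin m → ℝ) (hα : Matrix.vecMul α Q = 0)
    (Y : Matrix (Fin m) (Fin m) ℝ)
    (hY : Y ^ 2 + (2 : ℝ) • (V⁻¹ * D) * Y + (2 : ℝ) • (V⁻¹ * Q) = 0)
    (Ψ₁ : Matrix (Fin m) (Fin m) ℝ) (hΨ₁ : Ψ₁ = Θ * Y)
    (ζ₁ : Fin m → ℝ)
    (hζ₁ : ζ₁ = -(Matrix.vecMul α (Θ⁻¹ * D + (1 / 2 : ℝ) • (Θ * Ψ₁ * Θ⁻¹)))) :
    Matrix.vecMul ζ₁ Ψ₁ = 0 := by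
  have hdet : IsUnit Θ.det := by
    rw [hΘ, Matrix.det_diagonal]
    exact (Finset.prod_pos fun i _ => hσ i).ne'.isUnit
  have hVdet : IsUnit V.det := by
    rw [hV, Matrix.det_pow]
    exact hdet.pow 2
  have hcomm : D * Θ = Θ * D := by
    rw [hΘ, hD, Matrix.diagonal_mul_diagonal, Matrix.diagonal_mul_diagonal]
    simp only [mul_comm]
  have hquad : V * Y ^ 2 + (2 : ℝ) • (D * Y) + (2 : ℝ) • Q = 0 := by
    have h := congrArg (V * ·) hY
    simpa only [mul_add, Matrix.mul_smul, Matrix.smul_mul, Matrix.mul_assoc, mul_zero,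
      Matrix.mul_nonsing_inv_cancel_left V _ hVdet] using h
  have hdrift : Θ⁻¹ * D * (Θ * Y) = D * Y := by
    rw [← Matrix.mul_assoc, Matrix.mul_assoc Θ⁻¹, hcomm,
      Matrix.nonsing_inv_mul_cancel_left Θ _ hdet]
  have hsquare : Θ * (Θ * Y) * Θ⁻¹ * (Θ * Y) = V * Y ^ 2 := by
    rw [Matrix.mul_assoc _ Θ⁻¹, Matrix.nonsing_inv_mul_cancel_left Θ _ hdet, hV]
    simp only [pow_two, Matrix.mul_assoc]
  have hprod : (Θ⁻¹ * D + (1 / 2 : ℝ) • (Θ * (Θ * Y) * Θ⁻¹)) * (Θ * Y) = -Q := by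
    rw [add_mul, Matrix.smul_mul, hdrift, hsquare]
    linear_combination (norm := module) (1 / 2 : ℝ) • hquad
  rw [hζ₁, hΨ₁, Matrix.neg_vecMul, Matrix.vecMul_vecMul, hprod, Matrix.vecMul_neg, hα,
    neg_zero, neg_zero]
end
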